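/- arXiv:2108.10597 — 2 statements merged into one kernel-verified Lean document; each statement's English description precedes it below -/
import Mathlib

section
/- L¹–L² tent space embedding: for f on R²_+ (or R^{1+n}_+), (∫_{R^{1+n}_+} |f(t,y)|² t dt dy)^{1/2} ≲ ‖C(W₂ f)‖_{L²(R^n)}, where W₂f(t,x) is the L² Whitney average of f over the box (t/2,t)×Q(x,t) (Q(x,t) the cube centered at x of side t), and C is the Carleson functional Cg(x) = sup_{Q ∋ x}|Q|^{-1}∫_{Q^{ca}}|g|. -/
open MeasureTheory Set
open scoped ENNReal

noncomputable section

/-- The Whitney box `(t/2, t) × Q(x,t)`, where `Q(x,t)` is the (sup-norm) cube centered at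
`x` of side `t`. -/
def whitneyBox (n : ℕ) (t : ℝ) (x : Fin n → ℝ) : Set (ℝ × (Fin n → ℝ)) :=
  Set.Ioo (t / 2) t ×ˢ Metric.closedBall x (t / 2)

/-- The `L²` Whitney average `W₂ f(t,x)` of `f` over the box `(t/2,t) × Q(x,t)`. -/
def whitneyL2 (n : ℕ) (f : ℝ × (Fin n → ℝ) → ℝ) (p : ℝ × (Fin n → ℝ)) : ℝ≥0∞ :=
  ((ENNReal.ofReal (p.1 / 2 * p.1 ^ n))⁻¹ *
      ∫⁻ z in whitneyBox n p.1 p.2, ENNReal.ofReal |f z| ^ (2 : ℝ)) ^ ((2 : ℝ)⁻¹)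

/-- The Carleson functional `Cg(x) = sup_{Q ∋ x} |Q|⁻¹ ∫_{Q^{ca}} g` for
`ℝ≥0∞`-valued `g`, with `Q^{ca} = (0, ℓ(Q)) × Q`. -/
def carlesonE (n : ℕ) (g : ℝ × (Fin n → ℝ) → ℝ≥0∞) (x : Fin n → ℝ) : ℝ≥0∞ :=
  ⨆ (c : Fin n → ℝ) (ℓ : ℝ) (_ : 0 < ℓ) (_ : x ∈ Metric.closedBall c (ℓ / 2)),
    (ENNReal.ofReal (ℓ ^ n))⁻¹ *
      ∫⁻ z in Set.Ioo 0 ℓ ×ˢ Metric.closedBall c (ℓ / 2), g z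

/-- The cell of the grid of half-open cubes of side `s` that contains `x`. -/
def gridCell (n : ℕ) (s : ℝ) (x : Fin n → ℝ) : Set (Fin n → ℝ) :=
  {y | ∀ i, ⌊y i / s⌋ = ⌊x i / s⌋}

/-- The average of `T` over the grid cell of side `s` containing the given point. -/
def gridAvg (n : ℕ) (s : ℝ) (T : (Fin n → ℝ) → ℝ≥0∞) (x : Fin n → ℝ) : ℝ≥0∞ :=
  (ENNReal.ofReal (s ^ n))⁻¹ * ∫⁻ y in gridCell n s x, T y

lemma mem_gridCell_comm {n : ℕ} {s : ℝ} {x y : Fin n → ℝ} :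
    x ∈ gridCell n s y ↔ y ∈ gridCell n s x :=
  ⟨fun h i => (h i).symm, fun h i => (h i).symm⟩

lemma gridCell_eq {n : ℕ} {s : ℝ} {x y : Fin n → ℝ} (h : y ∈ gridCell n s x) :
    gridCell n s y = gridCell n s x := by
  ext z
  exact ⟨fun hz i => (hz i).trans (h i), fun hz i => (hz i).trans (h i).symm⟩

lemma gridCell_eq_pi {n : ℕ} {s : ℝ} (hs : 0 < s) (x : Fin n → ℝ) :
    gridCell n s x =
      Set.univ.pi fun i => Set.Ico (⌊x i / s⌋ * s) ((⌊x i / s⌋ + 1 : ℝ) * s) := by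
  ext y
  simp only [gridCell, Set.mem_ofPred_eq, Set.mem_pi, mem_univ, true_imp_iff, Int.floor_eq_iff,
    mem_Ico, le_div_iff₀ hs, div_lt_iff₀ hs]

lemma volume_gridCell {n : ℕ} {s : ℝ} (hs : 0 < s) (x : Fin n → ℝ) :
    volume (gridCell n s x) = ENNReal.ofReal (s ^ n) := by
  rw [gridCell_eq_pi hs, volume_pi_pi]
  have h : ∀ i, (⌊x i / s⌋ + 1 : ℝ) * s - ⌊x i / s⌋ * s = s := fun i => by ring
  simp [Real.volume_Ico, h, ENNReal.ofReal_pow hs.le]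

lemma measurableSet_gridCell_prod (n : ℕ) (s : ℝ) :
    MeasurableSet {p : (Fin n → ℝ) × (Fin n → ℝ) | p.2 ∈ gridCell n s p.1} := by
  have : {p : (Fin n → ℝ) × (Fin n → ℝ) | p.2 ∈ gridCell n s p.1} =
      ⋂ i, {p | ⌊p.2 i / s⌋ = ⌊p.1 i / s⌋} := by
    ext p; simp [gridCell]
  rw [this]
  refine MeasurableSet.iInter fun i => measurableSet_eq_fun ?_ ?_
  · exact Int.measurable_floor.comp (by fun_prop)
  · exact Int.measurable_floor.comp (by fun_prop)

lemma measurableSet_gridCell {n : ℕ} (s : ℝ) (x : Fin n → ℝ) :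
    MeasurableSet (gridCell n s x) :=
  (measurable_prodMk_left (x := x)) (measurableSet_gridCell_prod n s)

lemma gridCell_subset_two_mul {n : ℕ} (s : ℝ) (x : Fin n → ℝ) :
    gridCell n s x ⊆ gridCell n (2 * s) x := by
  intro y hy i
  have key : ∀ a : ℝ, ⌊a / (2 * s)⌋ = ⌊a / s⌋ / 2 := fun a => by
    rw [mul_comm, ← div_div]
    exact_mod_cast Int.floor_div_natCast (a / s) 2
  rw [key, key, hy i]

lemma gridCell_subset_closedBall {n : ℕ} {s : ℝ} (hs : 0 < s) (x : Fin n → ℝ) :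
    gridCell n s x ⊆ Metric.closedBall x s := by
  intro y hy
  rw [Metric.mem_closedBall, dist_pi_le_iff hs.le]
  intro i
  have h := (Int.abs_sub_lt_one_of_floor_eq_floor (hy i)).le
  rw [← sub_div, abs_div, abs_of_pos hs, div_le_one hs] at h
  rwa [Real.dist_eq]

lemma gridAvg_eq_lintegral_indicator {n : ℕ} (s : ℝ) (T : (Fin n → ℝ) → ℝ≥0∞)
    (x : Fin n → ℝ) :
    gridAvg n s T x = (ENNReal.ofReal (s ^ n))⁻¹ *
      ∫⁻ y, {p : (Fin n → ℝ) × (Fin n → ℝ) | p.2 ∈ gridCell n s p.1}.indicator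
        (fun p => T p.2) (x, y) := by
  rw [gridAvg, ← lintegral_indicator (measurableSet_gridCell s x)]
  rfl

lemma measurable_gridAvg {n : ℕ} (s : ℝ) {T : (Fin n → ℝ) → ℝ≥0∞} (hT : Measurable T) :
    Measurable (gridAvg n s T) := by
  have : gridAvg n s T = fun x => _ := funext (gridAvg_eq_lintegral_indicator s T)
  rw [this]
  refine Measurable.const_mul (Measurable.lintegral_prod_right' ?_) _
  exact (hT.comp measurable_snd).indicator (measurableSet_gridCell_prod n s)

lemma gridAvg_congr {n : ℕ} {s : ℝ} (T : (Fin n → ℝ) → ℝ≥0∞) {x y : Fin n → ℝ}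
    (h : y ∈ gridCell n s x) : gridAvg n s T y = gridAvg n s T x := by
  rw [gridAvg, gridAvg, gridCell_eq h]

lemma gridAvg_mono {n : ℕ} (s : ℝ) {T T' : (Fin n → ℝ) → ℝ≥0∞} (h : ∀ x, T x ≤ T' x)
    (x : Fin n → ℝ) : gridAvg n s T x ≤ gridAvg n s T' x := by
  unfold gridAvg
  gcongr
  exact h _

lemma gridAvg_eq_self {n : ℕ} {s : ℝ} (hs : 0 < s) {T : (Fin n → ℝ) → ℝ≥0∞}
    (hT : ∀ x, ∀ y ∈ gridCell n s x, T y = T x) (x : Fin n → ℝ) : gridAvg n s T x = T x := by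
  have h0 : ENNReal.ofReal (s ^ n) ≠ 0 := by simpa using pow_pos hs n
  rw [gridAvg, setLIntegral_congr_fun (measurableSet_gridCell s x) (hT x), setLIntegral_const,
    volume_gridCell hs, mul_comm (T x), ← mul_assoc,
    ENNReal.inv_mul_cancel h0 ENNReal.ofReal_ne_top, one_mul]

/-- Averaging over grid cells is self-adjoint and fixes functions constant on cells. -/
lemma lintegral_mul_gridAvg {n : ℕ} {s : ℝ} (hs : 0 < s) {φ T : (Fin n → ℝ) → ℝ≥0∞}
    (hφ : Measurable φ) (hT : Measurable T)
    (hc : ∀ x, ∀ y ∈ gridCell n s x, φ y = φ x) :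
    ∫⁻ x, φ x * gridAvg n s T x = ∫⁻ x, φ x * T x := by
  have hS := measurableSet_gridCell_prod n s
  set S := {p : (Fin n → ℝ) × (Fin n → ℝ) | p.2 ∈ gridCell n s p.1} with hSdef
  set c := (ENNReal.ofReal (s ^ n))⁻¹ with hcdef
  have h1 : ∀ x, φ x * gridAvg n s T x =
      ∫⁻ y, S.indicator (fun p => c * (φ p.1 * T p.2)) (x, y) := fun x => by
    have hm : Measurable fun y => S.indicator (fun p => T p.2) (x, y) :=
      ((hT.comp measurable_snd).indicator hS).comp measurable_prodMk_left
    rw [gridAvg_eq_lintegral_indicator, ← mul_assoc, ← lintegral_const_mul _ hm]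
    refine lintegral_congr fun y => ?_
    by_cases h : (x, y) ∈ S
    · rw [indicator_of_mem h, indicator_of_mem h]; ring
    · rw [indicator_of_notMem h, indicator_of_notMem h, mul_zero]
  have h2 : ∀ y, φ y * T y =
      ∫⁻ x, S.indicator (fun p => c * (φ p.1 * T p.2)) (x, y) := fun y => by
    have h3 : ∀ x, S.indicator (fun p => c * (φ p.1 * T p.2)) (x, y) =
        (gridCell n s y).indicator (fun _ => c * (φ y * T y)) x := fun x => by
      by_cases h : x ∈ gridCell n s y
      · have h' : (x, y) ∈ S := mem_gridCell_comm.1 h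
        rw [indicator_of_mem h, indicator_of_mem h', hc y x h]
      · have h' : (x, y) ∉ S := fun h' => h (mem_gridCell_comm.1 h')
        rw [indicator_of_notMem h, indicator_of_notMem h']
    have h0 : ENNReal.ofReal (s ^ n) ≠ 0 := by simpa using pow_pos hs n
    rw [lintegral_congr h3, lintegral_indicator (measurableSet_gridCell s y),
      setLIntegral_const, volume_gridCell hs, mul_right_comm, hcdef,
      ENNReal.inv_mul_cancel h0 ENNReal.ofReal_ne_top, one_mul]
  rw [lintegral_congr h1, lintegral_congr h2]
  refine lintegral_lintegral_swap (Measurable.aemeasurable ?_)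
  exact Measurable.indicator
    (((hφ.comp measurable_fst).mul (hT.comp measurable_snd)).const_mul c) hS

/-- Summation by parts for a nonnegative sequence `T k = a k + T (k + 1)` against the running
maxima of `M`. -/
lemma sum_mul_partialSups_add {a T M : ℕ → ℝ≥0∞} (hT : ∀ k, T k = a k + T (k + 1)) (N : ℕ) :
    ∑ k ∈ Finset.range (N + 1), a k * partialSups M k + T (N + 1) * partialSups M N =
      T 0 * M 0 + ∑ k ∈ Finset.range N,
        T (k + 1) * (partialSups M (k + 1) - partialSups M k) := by
  induction N with
  | zero => simp [hT 0, add_mul]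
  | succ N ih =>
    have hle : partialSups M N ≤ partialSups M (N + 1) := (partialSups M).mono N.le_succ
    rw [Finset.sum_range_succ _ N, ← add_assoc, ← ih, Finset.sum_range_succ _ (N + 1), add_assoc,
      ← add_mul, ← hT, add_assoc, ← mul_add, add_tsub_cancel_of_le hle]

/-- Carleson embedding for a dyadic filtration of grids. -/
lemma lintegral_sum_mul_gridAvg_le {n : ℕ} {s : ℕ → ℝ} (hs : ∀ k, 0 < s k)
    (hs2 : ∀ k, s k = 2 * s (k + 1)) {a T : ℕ → (Fin n → ℝ) → ℝ≥0∞}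
    (hTm : ∀ k, Measurable (T k)) (hT : ∀ k x, T k x = a k x + T (k + 1) x)
    {F : (Fin n → ℝ) → ℝ≥0∞} (hF : ∀ k x, gridAvg n (s k) (T k) x ≤ F x) (N : ℕ) :
    ∫⁻ x, ∑ k ∈ Finset.range (N + 1), a k x * gridAvg n (s k) (T k) x ≤
      ∫⁻ x, F x ^ (2 : ℕ) := by
  set M : ℕ → (Fin n → ℝ) → ℝ≥0∞ := fun k => gridAvg n (s k) (T k)
  set h : ℕ → (Fin n → ℝ) → ℝ≥0∞ := fun k x => partialSups (fun j => M j x) k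
  have hMm : ∀ k, Measurable (M k) := fun k => measurable_gridAvg _ (hTm k)
  have hsucc : ∀ k x, h (k + 1) x = h k x ⊔ M (k + 1) x := fun k x =>
    partialSups_add_one (fun j => M j x) k
  have h0 : ∀ x, h 0 x = M 0 x := fun x => partialSups_zero (fun j => M j x)
  have hmono : ∀ k x, h k x ≤ h (k + 1) x := fun k x =>
    (partialSups fun j => M j x).mono k.le_succ
  have hhm : ∀ k, Measurable (h k) := fun k => by
    induction k with
    | zero => exact (funext h0 : h 0 = M 0) ▸ hMm 0
    | succ k ih =>
      have : h (k + 1) = fun x => h k x ⊔ M (k + 1) x := funext (hsucc k)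
      rw [this]
      exact ih.sup (hMm _)
  have hhc : ∀ k x, ∀ y ∈ gridCell n (s k) x, h k y = h k x := fun k => by
    induction k with
    | zero => exact fun x y hy => by rw [h0, h0]; exact gridAvg_congr _ hy
    | succ k ih =>
      intro x y hy
      have hy' : y ∈ gridCell n (s k) x := hs2 k ▸ gridCell_subset_two_mul _ _ hy
      rw [hsucc, hsucc, ih x y hy', show M (k + 1) y = M (k + 1) x from gridAvg_congr _ hy]
  have hδm : ∀ k, Measurable fun x => h (k + 1) x - h k x := fun k => (hhm _).sub (hhm k)
  calc ∫⁻ x, ∑ k ∈ Finset.range (N + 1), a k x * M k x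
      ≤ ∫⁻ x, (M 0 x * T 0 x +
          ∑ k ∈ Finset.range N, (h (k + 1) x - h k x) * T (k + 1) x) := by
        refine lintegral_mono fun x => ?_
        have := sum_mul_partialSups_add (M := fun j => M j x) (fun k => hT k x) N
        simp only [mul_comm _ (T _ x)]
        refine le_trans ?_ this.le
        refine le_trans (Finset.sum_le_sum fun k _ => ?_) le_self_add
        gcongr
        exact le_partialSups (fun j => M j x) k
    _ = ∫⁻ x, (M 0 x * M 0 x +
          ∑ k ∈ Finset.range N, (h (k + 1) x - h k x) * M (k + 1) x) := by
        rw [lintegral_add_left (f := fun x => M 0 x * T 0 x) ((hMm 0).mul (hTm 0)),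
          lintegral_add_left (f := fun x => M 0 x * M 0 x) ((hMm 0).mul (hMm 0)),
          lintegral_finsetSum (f := fun k x => (h (k + 1) x - h k x) * T (k + 1) x) _
            fun k _ => (hδm k).mul (hTm _),
          lintegral_finsetSum (f := fun k x => (h (k + 1) x - h k x) * M (k + 1) x) _
            fun k _ => (hδm k).mul (hMm _)]
        congr 1
        · exact (lintegral_mul_gridAvg (hs 0) (hMm 0) (hTm 0)
            fun x y hy => gridAvg_congr _ hy).symm
        · refine Finset.sum_congr rfl fun k _ => ?_
          refine (lintegral_mul_gridAvg (hs _) (hδm k) (hTm _) fun x y hy => ?_).symm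
          have hy' : y ∈ gridCell n (s k) x := hs2 k ▸ gridCell_subset_two_mul _ _ hy
          rw [hhc _ x y hy, hhc _ x y hy']
    _ ≤ ∫⁻ x, F x ^ (2 : ℕ) := by
        refine lintegral_mono fun x => ?_
        have hhF : ∀ k, h k x ≤ F x := fun k => partialSups_le _ _ _ fun j _ => hF j x
        have htel : ∀ N, h 0 x + ∑ k ∈ Finset.range N, (h (k + 1) x - h k x) = h N x := by
          intro N
          induction N with
          | zero => simp
          | succ N ih =>
            rw [Finset.sum_range_succ, ← add_assoc, ih, add_tsub_cancel_of_le (hmono N x)]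
        calc M 0 x * M 0 x + ∑ k ∈ Finset.range N, (h (k + 1) x - h k x) * M (k + 1) x
            ≤ h 0 x * F x + ∑ k ∈ Finset.range N, (h (k + 1) x - h k x) * F x := by
              rw [h0]
              gcongr with k _
              · exact hF 0 x
              · exact hF _ x
          _ = h N x * F x := by rw [← Finset.sum_mul, ← add_mul, htel]
          _ ≤ F x ^ (2 : ℕ) := by rw [pow_two]; gcongr; exact hhF N

lemma measurable_whitneyL2 {n : ℕ} {f : ℝ × (Fin n → ℝ) → ℝ} (hf : Measurable f) :
    Measurable (whitneyL2 n f) := by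
  set S : Set ((ℝ × (Fin n → ℝ)) × (ℝ × (Fin n → ℝ))) := {q | q.2 ∈ whitneyBox n q.1.1 q.1.2}
  have hS : MeasurableSet S := by
    have : S = {q | q.1.1 / 2 < q.2.1} ∩ {q | q.2.1 < q.1.1} ∩
        {q | dist q.2.2 q.1.2 ≤ q.1.1 / 2} := by
      ext q; simp [S, whitneyBox, and_assoc]
    rw [this]
    refine ((measurableSet_lt ?_ ?_).inter (measurableSet_lt ?_ ?_)).inter
      (measurableSet_le ?_ ?_) <;> fun_prop
  have hbox : ∀ p : ℝ × (Fin n → ℝ), MeasurableSet (whitneyBox n p.1 p.2) := fun p =>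
    measurableSet_Ioo.prod measurableSet_closedBall
  have h1 : ∀ p : ℝ × (Fin n → ℝ),
      ∫⁻ z in whitneyBox n p.1 p.2, ENNReal.ofReal |f z| ^ (2 : ℝ) =
        ∫⁻ z, S.indicator (fun q => ENNReal.ofReal |f q.2| ^ (2 : ℝ)) (p, z) := fun p => by
    rw [← lintegral_indicator (hbox p)]; rfl
  unfold whitneyL2
  simp only [h1]
  refine Measurable.pow_const (Measurable.mul ?_ (Measurable.lintegral_prod_right' ?_)) _
  · fun_prop
  · exact Measurable.indicator (by fun_prop) hS

/-- Averages over grid cells of the vertical integrals of `g` are controlled by the Carleson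
functional. -/
lemma gridAvg_vertical_le {n : ℕ} {s : ℝ} (hs : 0 < s) {g : ℝ × (Fin n → ℝ) → ℝ≥0∞}
    (hg : Measurable g) (x : Fin n → ℝ) :
    gridAvg n s (fun y => ∫⁻ t in Set.Ioo 0 (4 * s), g (t, y)) x ≤ 4 ^ n * carlesonE n g x := by
  have h4 : 0 < 4 * s := by positivity
  have hx : x ∈ Metric.closedBall x (4 * s / 2) := Metric.mem_closedBall_self (by positivity)
  have hle : (ENNReal.ofReal ((4 * s) ^ n))⁻¹ *
      ∫⁻ z in Set.Ioo 0 (4 * s) ×ˢ Metric.closedBall x (4 * s / 2), g z ≤ carlesonE n g x :=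
    le_iSup₂_of_le x (4 * s) (le_iSup₂_of_le h4 hx le_rfl)
  have hsub : gridCell n s x ⊆ Metric.closedBall x (4 * s / 2) :=
    (gridCell_subset_closedBall hs x).trans (Metric.closedBall_subset_closedBall (by linarith))
  have hint : ∫⁻ y in gridCell n s x, ∫⁻ t in Set.Ioo 0 (4 * s), g (t, y) ≤
      ∫⁻ z in Set.Ioo 0 (4 * s) ×ˢ Metric.closedBall x (4 * s / 2), g z := by
    rw [Measure.volume_eq_prod, setLIntegral_prod_symm _ hg.aemeasurable]
    exact lintegral_mono_set hsub
  have hcoef : (ENNReal.ofReal (s ^ n))⁻¹ = 4 ^ n * (ENNReal.ofReal ((4 * s) ^ n))⁻¹ := by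
    rw [mul_pow, ENNReal.ofReal_mul (by positivity),
      ENNReal.mul_inv (Or.inr ENNReal.ofReal_ne_top) (Or.inl ENNReal.ofReal_ne_top),
      ENNReal.ofReal_pow (p := 4) (by norm_num), ENNReal.ofReal_ofNat, ← mul_assoc,
      ENNReal.mul_inv_cancel (by simp) (by simp), one_mul]
  rw [gridAvg, hcoef, mul_assoc]
  gcongr
  exact (mul_le_mul_right hint _).trans hle

lemma const_mul_rpow_le_whitneyL2 {n : ℕ} {s t u v : ℝ} (hs : 0 < s) (htl : 2 * s ≤ t)
    (htr : t ≤ 4 * s) (hu : t / 2 < u) (hv : v ≤ t) {f : ℝ × (Fin n → ℝ) → ℝ}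
    (hf : Measurable f) (x : Fin n → ℝ) :
    ((ENNReal.ofReal (4 ^ (n + 1) * s))⁻¹ *
        gridAvg n s (fun y => ∫⁻ τ in Set.Ico u v, ENNReal.ofReal |f (τ, y)| ^ (2 : ℝ)) x)
          ^ ((2 : ℝ)⁻¹) ≤ whitneyL2 n f (t, x) := by
  have ht : 0 < t := by linarith
  have hsub : Set.Ico u v ×ˢ gridCell n s x ⊆ whitneyBox n t x := by
    refine Set.prod_mono (fun τ hτ => ⟨hu.trans_le hτ.1, hτ.2.trans_le hv⟩) ?_
    exact (gridCell_subset_closedBall hs x).trans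
      (Metric.closedBall_subset_closedBall (by linarith))
  unfold whitneyL2 gridAvg
  refine ENNReal.rpow_le_rpow ?_ (by norm_num)
  rw [← mul_assoc,
    ← ENNReal.mul_inv (Or.inr ENNReal.ofReal_ne_top) (Or.inl ENNReal.ofReal_ne_top), ← ENNReal.ofReal_mul (by positivity)]
  refine mul_le_mul' (ENNReal.inv_le_inv.2 (ENNReal.ofReal_le_ofReal ?_)) ?_
  · have h1 : t ^ n ≤ (4 * s) ^ n := pow_le_pow_left₀ ht.le htr n
    calc t / 2 * t ^ n ≤ (4 * s) * (4 * s) ^ n := by gcongr; linarith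
      _ = 4 ^ (n + 1) * s * s ^ n := by rw [mul_pow]; ring
  · refine le_trans (le_of_eq ?_) (lintegral_mono_set hsub)
    rw [Measure.volume_eq_prod, setLIntegral_prod_symm]
    fun_prop

/-- The vertical integral of the Whitney averages over one dyadic layer dominates the `L²` mean
of `f` over a Whitney region. -/
lemma const_mul_rpow_le_lintegral_whitneyL2 {n : ℕ} {s : ℝ} (hs : 0 < s)
    {f : ℝ × (Fin n → ℝ) → ℝ} (hf : Measurable f) (x : Fin n → ℝ) :
    ENNReal.ofReal s * ((ENNReal.ofReal (4 ^ (n + 1) * s))⁻¹ *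
        gridAvg n s (fun y => ∫⁻ τ in Set.Ico (3 / 2 * s) (3 * s),
          ENNReal.ofReal |f (τ, y)| ^ (2 : ℝ)) x) ^ ((2 : ℝ)⁻¹) ≤
      ∫⁻ t in Set.Ico (2 * s) (4 * s), whitneyL2 n f (t, x) := by
  set A : ℝ → ℝ → ℝ≥0∞ := fun u v => ((ENNReal.ofReal (4 ^ (n + 1) * s))⁻¹ *
    gridAvg n s (fun y => ∫⁻ τ in Set.Ico u v, ENNReal.ofReal |f (τ, y)| ^ (2 : ℝ)) x) with hA
  have hsplit : A (3 / 2 * s) (3 * s) = A (3 / 2 * s) (2 * s) + A (2 * s) (3 * s) := by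
    have hm : Measurable fun y => ∫⁻ τ in Set.Ico (3 / 2 * s) (2 * s),
        ENNReal.ofReal |f (τ, y)| ^ (2 : ℝ) := by
      refine Measurable.lintegral_prod_left' (f := fun p : ℝ × (Fin n → ℝ) =>
        ENNReal.ofReal |f p| ^ (2 : ℝ)) (by fun_prop)
    simp only [hA, gridAvg]
    rw [← mul_add, ← mul_add, ← lintegral_add_left hm]
    congr 3
    ext y
    rw [← lintegral_union measurableSet_Ico (Set.Ico_disjoint_Ico_same),
      Set.Ico_union_Ico_eq_Ico (by linarith) (by linarith)]
  have hpiece : ∀ u v l r : ℝ, r - l = s → 2 * s ≤ l → r ≤ 4 * s → r / 2 ≤ u → v ≤ l →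
      ENNReal.ofReal s * A u v ^ ((2 : ℝ)⁻¹) ≤
        ∫⁻ t in Set.Ico l r, whitneyL2 n f (t, x) := by
    intro u v l r hlr hl hr hu hv
    have hvol : ENNReal.ofReal s = volume (Set.Ico l r) := by rw [Real.volume_Ico, hlr]
    rw [hvol, mul_comm, ← setLIntegral_const]
    refine setLIntegral_mono' measurableSet_Ico fun t ht => ?_
    exact const_mul_rpow_le_whitneyL2 hs (hl.trans ht.1) (ht.2.le.trans hr)
      (by linarith [ht.2]) (hv.trans ht.1) hf x
  change ENNReal.ofReal s * A (3 / 2 * s) (3 * s) ^ ((2 : ℝ)⁻¹) ≤ _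
  calc ENNReal.ofReal s * A (3 / 2 * s) (3 * s) ^ ((2 : ℝ)⁻¹)
      ≤ ENNReal.ofReal s * A (3 / 2 * s) (2 * s) ^ ((2 : ℝ)⁻¹) +
          ENNReal.ofReal s * A (2 * s) (3 * s) ^ ((2 : ℝ)⁻¹) := by
        rw [hsplit, ← mul_add (ENNReal.ofReal s)]
        exact mul_le_mul_right
          (ENNReal.rpow_add_le_add_rpow _ _ (by norm_num : (0 : ℝ) ≤ 2⁻¹) (by norm_num)) _
    _ ≤ (∫⁻ t in Set.Ico (2 * s) (3 * s), whitneyL2 n f (t, x)) +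
          ∫⁻ t in Set.Ico (3 * s) (4 * s), whitneyL2 n f (t, x) :=
        add_le_add
          (hpiece _ _ _ _ (by ring) (by linarith) (by linarith) (by linarith) (by linarith))
          (hpiece _ _ _ _ (by ring) (by linarith) (by linarith) (by linarith) (by linarith))
    _ = ∫⁻ t in Set.Ico (2 * s) (4 * s), whitneyL2 n f (t, x) := by
        rw [← lintegral_union measurableSet_Ico (Set.Ico_disjoint_Ico_same),
          Set.Ico_union_Ico_eq_Ico (by linarith) (by linarith)]

/-- The energy of `f` in one dyadic layer is controlled by the Whitney averages. -/
lemma lintegral_layer_le {n : ℕ} {s : ℝ} (hs : 0 < s) {f : ℝ × (Fin n → ℝ) → ℝ}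
    (hf : Measurable f) :
    ∫⁻ z in Set.Ico (3 / 2 * s) (3 * s) ×ˢ Set.univ,
        ENNReal.ofReal |f z| ^ (2 : ℝ) * ENNReal.ofReal z.1 ≤
      4 ^ (n + 2) * ∫⁻ x, (∫⁻ t in Set.Ico (2 * s) (4 * s), whitneyL2 n f (t, x)) *
        gridAvg n s (fun y => ∫⁻ t in Set.Ioo 0 (4 * s), whitneyL2 n f (t, y)) x := by
  set B : (Fin n → ℝ) → ℝ≥0∞ := fun y => ∫⁻ τ in Set.Ico (3 / 2 * s) (3 * s),
    ENNReal.ofReal |f (τ, y)| ^ (2 : ℝ) with hB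
  have hBm : Measurable B := Measurable.lintegral_prod_left' (f := fun p : ℝ × (Fin n → ℝ) =>
    ENNReal.ofReal |f p| ^ (2 : ℝ)) (by fun_prop)
  set L : (Fin n → ℝ) → ℝ≥0∞ := fun x => ENNReal.ofReal s *
    ((ENNReal.ofReal (4 ^ (n + 1) * s))⁻¹ * gridAvg n s B x) ^ ((2 : ℝ)⁻¹) with hL
  have hL1 : ∀ x, L x ≤ ∫⁻ t in Set.Ico (2 * s) (4 * s), whitneyL2 n f (t, x) :=
    const_mul_rpow_le_lintegral_whitneyL2 hs hf
  have hL2 : ∀ x, L x ≤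
      gridAvg n s (fun y => ∫⁻ t in Set.Ioo 0 (4 * s), whitneyL2 n f (t, y)) x := fun x => by
    have hc : ∀ x, ∀ y ∈ gridCell n s x, L y = L x := fun x y hy => by
      simp only [hL, gridAvg_congr B hy]
    rw [← gridAvg_eq_self hs hc x]
    refine gridAvg_mono s (fun y => (hL1 y).trans (lintegral_mono_set fun t ht => ?_)) x
    exact ⟨by linarith [ht.1], ht.2⟩
  have hsq : ∀ x, ENNReal.ofReal s * gridAvg n s B x = 4 ^ (n + 1) * (L x * L x) := fun x => by
    have h1 : ∀ c : ℝ≥0∞, c ^ ((2 : ℝ)⁻¹) * c ^ ((2 : ℝ)⁻¹) = c := fun c => by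
      rw [← ENNReal.rpow_add_of_nonneg _ _ (by norm_num) (by norm_num)]; norm_num
    have hs0 : ENNReal.ofReal s ≠ 0 := by simpa using hs
    have h4 : (4 : ℝ≥0∞) ^ (n + 1) ≠ 0 := by simp
    have h4' : (4 : ℝ≥0∞) ^ (n + 1) ≠ ∞ := by simp
    simp only [hL]
    rw [mul_mul_mul_comm, h1, ENNReal.ofReal_mul (by positivity),
      ENNReal.mul_inv (by simp) (by simp), ENNReal.ofReal_pow (by norm_num),
      ENNReal.ofReal_ofNat]
    calc ENNReal.ofReal s * gridAvg n s B x
        = (4 ^ (n + 1) * (4 ^ (n + 1))⁻¹) * (ENNReal.ofReal s * (ENNReal.ofReal s)⁻¹) *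
            (ENNReal.ofReal s * gridAvg n s B x) := by
          rw [ENNReal.mul_inv_cancel h4 h4', ENNReal.mul_inv_cancel hs0 ENNReal.ofReal_ne_top]
          simp
      _ = _ := by ring
  calc ∫⁻ z in Set.Ico (3 / 2 * s) (3 * s) ×ˢ Set.univ,
        ENNReal.ofReal |f z| ^ (2 : ℝ) * ENNReal.ofReal z.1
      ≤ ∫⁻ z in Set.Ico (3 / 2 * s) (3 * s) ×ˢ Set.univ,
        ENNReal.ofReal |f z| ^ (2 : ℝ) * ENNReal.ofReal (4 * s) := by
        refine setLIntegral_mono' (measurableSet_Ico.prod MeasurableSet.univ) fun z hz => ?_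
        gcongr
        linarith [hz.1.2]
    _ = 4 * ∫⁻ x, ENNReal.ofReal s * B x := by
        rw [lintegral_mul_const _ (by fun_prop), Measure.volume_eq_prod,
          setLIntegral_prod_symm _ (by fun_prop), setLIntegral_univ, lintegral_const_mul _ hBm,
          ENNReal.ofReal_mul (by norm_num), ENNReal.ofReal_ofNat, hB]
        ring
    _ = 4 * (4 ^ (n + 1) * ∫⁻ x, L x * L x) := by
        rw [← lintegral_mul_gridAvg hs measurable_const hBm fun _ _ _ => rfl]
        simp only [hsq]
        rw [lintegral_const_mul' _ _ (by simp)]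
    _ ≤ 4 * (4 ^ (n + 1) * ∫⁻ x, (∫⁻ t in Set.Ico (2 * s) (4 * s), whitneyL2 n f (t, x)) *
        gridAvg n s (fun y => ∫⁻ t in Set.Ioo 0 (4 * s), whitneyL2 n f (t, y)) x) := by
        gcongr with x
        · exact hL1 x
        · exact hL2 x
    _ = _ := by ring

lemma sum_lintegral_layer_le {n : ℕ} {s : ℕ → ℝ} (hs : ∀ k, 0 < s k)
    (hs2 : ∀ k, s k = 2 * s (k + 1)) {f : ℝ × (Fin n → ℝ) → ℝ} (hf : Measurable f) (N : ℕ) :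
    ∑ k ∈ Finset.range (N + 1), ∫⁻ z in Set.Ico (3 / 2 * s k) (3 * s k) ×ˢ Set.univ,
        ENNReal.ofReal |f z| ^ (2 : ℝ) * ENNReal.ofReal z.1 ≤
      4 ^ (3 * n + 2) * ∫⁻ x, carlesonE n (whitneyL2 n f) x ^ (2 : ℝ) := by
  have hg := measurable_whitneyL2 hf
  set a : ℕ → (Fin n → ℝ) → ℝ≥0∞ := fun k x =>
    ∫⁻ t in Set.Ico (2 * s k) (4 * s k), whitneyL2 n f (t, x) with ha
  set T : ℕ → (Fin n → ℝ) → ℝ≥0∞ := fun k x =>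
    ∫⁻ t in Set.Ioo 0 (4 * s k), whitneyL2 n f (t, x) with hTdef
  have ham : ∀ k, Measurable (a k) := fun k => Measurable.lintegral_prod_left' hg
  have hTm : ∀ k, Measurable (T k) := fun k => Measurable.lintegral_prod_left' hg
  have hT : ∀ k x, T k x = a k x + T (k + 1) x := fun k x => by
    have h1 : 4 * s (k + 1) = 2 * s k := by rw [hs2 k]; ring
    have h2 : 0 < 2 * s k := by linarith [hs k]
    simp only [ha, hTdef, h1]
    rw [add_comm, ← lintegral_union measurableSet_Ico, Set.Ioo_union_Ico_eq_Ioo h2]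
    · linarith [hs k]
    · exact Set.disjoint_left.2 fun t ht ht' => ht.2.not_ge ht'.1
  have hF : ∀ k x, gridAvg n (s k) (T k) x ≤ 4 ^ n * carlesonE n (whitneyL2 n f) x :=
    fun k => gridAvg_vertical_le (hs k) hg
  calc ∑ k ∈ Finset.range (N + 1), ∫⁻ z in Set.Ico (3 / 2 * s k) (3 * s k) ×ˢ Set.univ,
        ENNReal.ofReal |f z| ^ (2 : ℝ) * ENNReal.ofReal z.1
      ≤ ∑ k ∈ Finset.range (N + 1),
          4 ^ (n + 2) * ∫⁻ x, a k x * gridAvg n (s k) (T k) x :=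
        Finset.sum_le_sum fun k _ => lintegral_layer_le (hs k) hf
    _ = 4 ^ (n + 2) *
          ∫⁻ x, ∑ k ∈ Finset.range (N + 1), a k x * gridAvg n (s k) (T k) x := by
        rw [← Finset.mul_sum, lintegral_finsetSum
          (f := fun k x => a k x * gridAvg n (s k) (T k) x) _ fun k _ =>
          (ham k).mul (measurable_gridAvg _ (hTm k))]
    _ ≤ 4 ^ (n + 2) * ∫⁻ x, (4 ^ n * carlesonE n (whitneyL2 n f) x) ^ (2 : ℕ) := by
        exact mul_le_mul_right (lintegral_sum_mul_gridAvg_le hs hs2 hTm hT hF N) _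
    _ = 4 ^ (3 * n + 2) * ∫⁻ x, carlesonE n (whitneyL2 n f) x ^ (2 : ℝ) := by
        simp only [mul_pow, ENNReal.rpow_ofNat]
        rw [lintegral_const_mul' _ _ (by simp)]
        ring

lemma lintegral_upperHalf_le {n : ℕ} {f : ℝ × (Fin n → ℝ) → ℝ} (hf : Measurable f) :
    ∫⁻ z in {z : ℝ × (Fin n → ℝ) | 0 < z.1},
        ENNReal.ofReal |f z| ^ (2 : ℝ) * ENNReal.ofReal z.1 ≤
      4 ^ (3 * n + 2) * ∫⁻ x, carlesonE n (whitneyL2 n f) x ^ (2 : ℝ) := by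
  set W : ℤ → Set (ℝ × (Fin n → ℝ)) := fun k =>
    Set.Ico (3 / 2 * (2 : ℝ) ^ k) (3 * (2 : ℝ) ^ k) ×ˢ Set.univ with hW
  have hcover : {z : ℝ × (Fin n → ℝ) | 0 < z.1} ⊆ ⋃ k, W k := fun z hz => by
    have hz' : 0 < z.1 / (3 / 2) := div_pos hz (by norm_num)
    obtain ⟨k, hk1, hk2⟩ := exists_mem_Ico_zpow hz' (one_lt_two (α := ℝ))
    rw [zpow_add_one₀ two_ne_zero] at hk2
    refine mem_iUnion.2 ⟨k, ⟨?_, ?_⟩, mem_univ _⟩ <;> linarith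
  refine (lintegral_mono_set hcover).trans ((lintegral_iUnion_le _ _).trans ?_)
  rw [ENNReal.tsum_eq_iSup_sum]
  refine iSup_le fun I => ?_
  obtain ⟨m, hm⟩ : ∃ m : ℕ, ∀ k ∈ I, k.natAbs ≤ m :=
    ⟨I.sup Int.natAbs, fun k hk => Finset.le_sup hk⟩
  set e : ℕ → ℤ := fun i => (m : ℤ) - i
  have he : Function.Injective e := fun i j h => by simpa [e] using h
  have hI : I ⊆ (Finset.range (2 * m + 1)).map ⟨e, he⟩ := fun k hk => by
    have := hm k hk
    refine Finset.mem_map.2 ⟨((m : ℤ) - k).toNat, Finset.mem_range.2 (by omega), ?_⟩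
    simp only [Function.Embedding.coeFn_mk, e]
    omega
  refine (Finset.sum_le_sum_of_subset hI).trans ?_
  rw [Finset.sum_map]
  refine sum_lintegral_layer_le (s := fun i => (2 : ℝ) ^ e i) (fun _ => by positivity)
    (fun k => ?_) hf (2 * m)
  rw [mul_comm, ← zpow_add_one₀ two_ne_zero]
  congr 1
  simp only [e]
  push_cast
  ring

/-- `L¹`–`L²` tent space embedding:
`(∫_{ℝ^{1+n}_+} |f(t,y)|² t dt dy)^{1/2} ≤ C ‖C(W₂ f)‖_{L²(ℝ^n)}`. -/
theorem tent_space_embedding (n : ℕ) :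
    ∃ C : ℝ, 0 < C ∧ ∀ f : ℝ × (Fin n → ℝ) → ℝ, Measurable f →
      (∫⁻ z in {z : ℝ × (Fin n → ℝ) | 0 < z.1},
          ENNReal.ofReal |f z| ^ (2 : ℝ) * ENNReal.ofReal z.1) ^ ((2 : ℝ)⁻¹)
        ≤ ENNReal.ofReal C *
            (∫⁻ x, carlesonE n (whitneyL2 n f) x ^ (2 : ℝ)) ^ ((2 : ℝ)⁻¹) := by
  refine ⟨2 ^ (3 * n + 2), by positivity, fun f hf => ?_⟩
  have hC : ENNReal.ofReal (2 ^ (3 * n + 2)) = ((4 : ℝ≥0∞) ^ (3 * n + 2)) ^ ((2 : ℝ)⁻¹) := by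
    rw [show (4 : ℝ≥0∞) = 2 ^ 2 by norm_num, ← pow_mul, mul_comm 2, pow_mul,
      ← ENNReal.rpow_ofNat _ 2, ← ENNReal.rpow_mul, ENNReal.ofReal_pow (by norm_num)]
    norm_num
  rw [hC, ← ENNReal.mul_rpow_of_nonneg _ _ (by norm_num)]
  exact ENNReal.rpow_le_rpow (lintegral_upperHalf_le hf) (by norm_num)
end
end

section
/- Horizontal Hilbert transform counterexample, lower bound: for f_N(t,x) = ∑_{j=0}^{N} ∑_{k=2^j}^{2^{j+1}−1} 2^k 1_{(2^{-k},2^{1-k})}(t) 1_{(k2^{-j}−1,(k+1)2^{-j}−1)}(x), the Hilbert transform H acting in x satisfies ∫₀¹ |Hf_N(t,x)| dx ≈ 2^{k−j}(j+1) for t ∈ (2^{-k}, 2^{1-k}) with 2^j ≤ k < 2^{j+1}, and consequently ∫_{[0,1]²} |Hf_N| dt dx ≈ N². -/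
open MeasureTheory Set Filter
open scoped ENNReal Classical Topology

noncomputable section

/-- The function
`f_N(t,x) = ∑_{j=0}^N ∑_{k=2^j}^{2^{j+1}-1} 2^k 1_{(2^{-k},2^{1-k})}(t) 1_{(k2^{-j}-1,(k+1)2^{-j}-1)}(x)`. -/
def fH (N : ℕ) (t x : ℝ) : ℝ :=
  ∑ j ∈ Finset.range (N + 1), ∑ k ∈ Finset.Ico (2 ^ j) (2 ^ (j + 1)),
    if t ∈ Set.Ioo ((2 : ℝ) ^ (-(k : ℤ))) ((2 : ℝ) ^ (1 - (k : ℤ))) ∧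
       x ∈ Set.Ioo ((k : ℝ) * 2 ^ (-(j : ℤ)) - 1) (((k : ℝ) + 1) * 2 ^ (-(j : ℤ)) - 1)
    then (2 : ℝ) ^ k else 0

/-- The (countable, null) set of endpoints of the rectangles, where the principal value need
not exist. -/
def dyadicBad : Set ℝ := {x | ∃ (j : ℕ) (m : ℤ), x = (m : ℝ) * 2 ^ (-(j : ℤ)) - 1}

/-- `Hf : (t,x) ↦ Hf(t,x)` is the horizontal Hilbert transform of `f_N`, i.e. the principal
value `π⁻¹ p.v. ∫ f_N(t,y)/(x-y) dy`, at every `x` outside the countable exceptional set. -/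
def IsHilbertOf (N : ℕ) (Hf : ℝ → ℝ → ℝ) : Prop :=
  ∀ t x : ℝ, x ∉ dyadicBad →
    Tendsto (fun ε : ℝ => (1 / Real.pi) * ∫ y in {y : ℝ | ε < |x - y|}, fH N t y / (x - y))
      (𝓝[>] 0) (𝓝 (Hf t x))

lemma setIntegral_Ioo_inv_sub {x p q : ℝ} (hpq : p ≤ q) (hx : x < p ∨ q < x) :
    ∫ y in Ioo p q, 1 / (x - y) = Real.log (x - p) - Real.log (x - q) := by
  rw [← integral_Ioc_eq_integral_Ioo, ← intervalIntegral.integral_of_le hpq,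
    intervalIntegral.integral_comp_sub_left (fun u : ℝ => 1 / u) x, integral_one_div,
    Real.log_div]
  · rcases hx with h | h
    · exact (sub_neg.2 (by linarith)).ne
    · exact (sub_pos.2 (by linarith)).ne'
  · rcases hx with h | h
    · exact (sub_neg.2 (by linarith)).ne
    · exact (sub_pos.2 (by linarith)).ne'
  · rw [uIcc_of_le (by linarith), mem_Icc]
    rintro ⟨h1, h2⟩
    rcases hx with h | h <;> linarith

lemma integrableOn_inv_sub {x p q : ℝ} (hx : x < p ∨ q < x) :
    IntegrableOn (fun y => 1 / (x - y)) (Ioo p q) := by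
  refine IntegrableOn.mono_set (t := Icc p q) ?_ Ioo_subset_Icc_self
  refine ContinuousOn.integrableOn_Icc ?_
  refine continuousOn_const.div (by fun_prop) fun y hy => ?_
  have := hy.1
  have := hy.2
  intro h
  rcases hx with h' | h' <;> linarith

lemma tendsto_truncated_integral_indicator {a b x : ℝ} (c : ℝ) (hab : a < b) (hxa : x ≠ a)
    (hxb : x ≠ b) :
    Tendsto (fun ε : ℝ => ∫ y in {y : ℝ | ε < |x - y|}, (if y ∈ Ioo a b then c else 0) / (x - y))
      (𝓝[>] 0) (𝓝 (c * (Real.log (x - a) - Real.log (x - b)))) := by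
  refine tendsto_const_nhds.congr' ?_
  have key : ∀ ε : ℝ,
      ∫ y in {y : ℝ | ε < |x - y|}, (if y ∈ Ioo a b then c else 0) / (x - y) =
        c * ∫ y in {y : ℝ | ε < |x - y|} ∩ Ioo a b, 1 / (x - y) := by
    intro ε
    rw [← integral_const_mul, ← setIntegral_indicator measurableSet_Ioo]
    congr 1
    ext y
    by_cases hy : y ∈ Ioo a b <;> simp [hy, indicator, div_eq_mul_inv]
  have hδ : 0 < min |x - a| |x - b| :=
    lt_min (abs_pos.2 (sub_ne_zero.2 hxa)) (abs_pos.2 (sub_ne_zero.2 hxb))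
  filter_upwards [Ioo_mem_nhdsGT hδ] with ε hε
  obtain ⟨hε0, hε1⟩ := hε
  obtain ⟨hεa, hεb⟩ := lt_min_iff.1 hε1
  rw [key]
  congr 1
  by_cases hx : x < a ∨ b < x
  · have hs : {y : ℝ | ε < |x - y|} ∩ Ioo a b = Ioo a b := by
      refine inter_eq_right.2 fun y hy => ?_
      have h1 := hy.1
      have h2 := hy.2
      simp only [mem_ofPred_eq]
      rw [lt_abs] at hεa hεb ⊢
      grind
    rw [hs, setIntegral_Ioo_inv_sub hab.le hx]
  · push Not at hx
    have hax : a < x := lt_of_le_of_ne hx.1 hxa.symm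
    have hbx : x < b := lt_of_le_of_ne hx.2 hxb
    rw [abs_of_pos (by linarith)] at hεa
    rw [abs_of_neg (by linarith)] at hεb
    have hs : {y : ℝ | ε < |x - y|} ∩ Ioo a b = Ioo a (x - ε) ∪ Ioo (x + ε) b := by
      ext y
      simp only [mem_inter_iff, mem_ofPred_eq, mem_Ioo, mem_union, lt_abs]
      grind
    rw [hs, setIntegral_union _ measurableSet_Ioo (integrableOn_inv_sub (by right; linarith))
      (integrableOn_inv_sub (by left; linarith)),
      setIntegral_Ioo_inv_sub (by linarith) (by right; linarith),
      setIntegral_Ioo_inv_sub (by linarith) (by left; linarith),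
      show x - (x - ε) = ε by ring, show x - (x + ε) = -ε by ring, Real.log_neg_eq_log]
    · ring
    · rw [Set.disjoint_left]
      intro y hy hy'
      have := hy.2
      have := hy'.1
      linarith

lemma intervalIntegrable_log_sub (a p q : ℝ) :
    IntervalIntegrable (fun x => Real.log (x - a)) volume p q := by
  simpa using (intervalIntegral.intervalIntegrable_log' (a := p - a) (b := q - a)).comp_sub_right a

lemma integral_log_sub (a p q : ℝ) :
    ∫ x in p..q, Real.log (x - a) =
      (q - a) * Real.log (q - a) - (p - a) * Real.log (p - a) - q + p := by
  rw [intervalIntegral.integral_comp_sub_right (fun x => Real.log x), integral_log]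
  ring

/-- The `L¹(0,1)` norm of `log |(x - a) / (x - b)|`. -/
lemma integral_abs_log_sub_log {a b : ℝ} (ha : 0 ≤ a) (hab : a < b) (hb : b ≤ 1) :
    ∫ x in (0 : ℝ)..1, |Real.log (x - a) - Real.log (x - b)| =
      (b * Real.log b - a * Real.log a) +
        ((1 - a) * Real.log (1 - a) - (1 - b) * Real.log (1 - b)) -
        2 * (b - a) * Real.log ((b - a) / 2) := by
  have hint : ∀ p q, IntervalIntegrable (fun x => |Real.log (x - a) - Real.log (x - b)|)
      volume p q := fun p q =>
    ((intervalIntegrable_log_sub a p q).sub (intervalIntegrable_log_sub b p q)).abs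
  rw [← intervalIntegral.integral_add_adjacent_intervals (hint 0 ((a + b) / 2)) (hint _ 1)]
  have hleft : ∫ x in (0 : ℝ)..((a + b) / 2), |Real.log (x - a) - Real.log (x - b)| =
      ∫ x in (0 : ℝ)..((a + b) / 2), (Real.log (x - b) - Real.log (x - a)) := by
    refine intervalIntegral.integral_congr_ae ?_
    have : ∀ᵐ x : ℝ, x ≠ a := by simp [ae_iff]
    filter_upwards [this] with x hxa hx
    rw [uIoc_of_le (by linarith)] at hx
    have h2 := hx.2
    rw [abs_of_nonpos, neg_sub]
    rw [sub_nonpos, ← Real.log_abs (x - a), ← Real.log_abs (x - b)]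
    refine Real.log_le_log (abs_pos.2 (sub_ne_zero.2 hxa)) ?_
    rw [abs_of_neg (show x - b < 0 by linarith), abs_le]
    constructor <;> linarith
  have hright : ∫ x in ((a + b) / 2)..(1 : ℝ), |Real.log (x - a) - Real.log (x - b)| =
      ∫ x in ((a + b) / 2)..(1 : ℝ), (Real.log (x - a) - Real.log (x - b)) := by
    refine intervalIntegral.integral_congr_ae ?_
    have : ∀ᵐ x : ℝ, x ≠ b := by simp [ae_iff]
    filter_upwards [this] with x hxb hx
    rw [uIoc_of_le (by linarith)] at hx
    have h2 := hx.1
    rw [abs_of_nonneg]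
    rw [sub_nonneg, ← Real.log_abs (x - a), ← Real.log_abs (x - b)]
    refine Real.log_le_log (abs_pos.2 (sub_ne_zero.2 hxb)) ?_
    rw [abs_of_pos (show 0 < x - a by linarith), abs_le]
    constructor <;> linarith
  rw [hleft, hright, intervalIntegral.integral_sub (intervalIntegrable_log_sub _ _ _)
    (intervalIntegrable_log_sub _ _ _), intervalIntegral.integral_sub
    (intervalIntegrable_log_sub _ _ _) (intervalIntegrable_log_sub _ _ _)]
  simp only [integral_log_sub]
  rw [show (a + b) / 2 - b = -((b - a) / 2) by ring, show (a + b) / 2 - a = (b - a) / 2 by ring]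
  simp only [zero_sub, Real.log_neg_eq_log]
  ring

lemma mul_log_add_sub_bounds {L h : ℝ} (hL : 0 ≤ L) (hh : 0 < h) :
    h * Real.log (L + h) ≤ (L + h) * Real.log (L + h) - L * Real.log L ∧
    (L + h) * Real.log (L + h) - L * Real.log L ≤ h * Real.log (L + h) + h := by
  rcases hL.eq_or_lt with rfl | hL
  · simp [hh.le]
  · have hlog : Real.log L ≤ Real.log (L + h) := Real.log_le_log hL (by linarith)
    have hup : Real.log (L + h) - Real.log L ≤ h / L := by
      rw [← Real.log_div (by positivity) hL.ne']
      refine (Real.log_le_sub_one_of_pos (by positivity)).trans_eq ?_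
      field_simp
      ring
    have hup' := mul_le_mul_of_nonneg_left hup hL.le
    rw [mul_div_cancel₀ _ hL.ne'] at hup'
    constructor <;> nlinarith

lemma integral_abs_log_sub_log_bounds {a b : ℝ} (ha : 0 ≤ a) (hab : a < b) (hb : b ≤ 1) :
    (b - a) * (Real.log 2 - Real.log (b - a)) ≤
        ∫ x in (0 : ℝ)..1, |Real.log (x - a) - Real.log (x - b)| ∧
      ∫ x in (0 : ℝ)..1, |Real.log (x - a) - Real.log (x - b)| ≤
        (b - a) * (4 - 2 * Real.log (b - a)) := by
  rw [integral_abs_log_sub_log ha hab hb, Real.log_div (by linarith) two_ne_zero]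
  have hh : 0 < b - a := by linarith
  obtain ⟨h1, h2⟩ := mul_log_add_sub_bounds ha hh
  obtain ⟨h3, h4⟩ := mul_log_add_sub_bounds (show 0 ≤ 1 - b by linarith) hh
  rw [show a + (b - a) = b by ring] at h1 h2
  rw [show 1 - b + (b - a) = 1 - a by ring] at h3 h4
  have hb0 : Real.log b ≤ 0 := Real.log_nonpos (by linarith) hb
  have ha0 : Real.log (1 - a) ≤ 0 := Real.log_nonpos (by linarith) (by linarith)
  have hhb : Real.log (b - a) ≤ Real.log b := Real.log_le_log hh (by linarith)
  have hha : Real.log (b - a) ≤ Real.log (1 - a) := Real.log_le_log hh (by linarith)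
  have hl2 : Real.log 2 ≤ 1 := by linarith [Real.log_two_lt_d9]
  constructor
  · have hor : - Real.log 2 ≤ Real.log b ∨ - Real.log 2 ≤ Real.log (1 - a) := by
      rw [← Real.log_inv]
      by_cases hc : (2 : ℝ)⁻¹ ≤ b
      · exact Or.inl (Real.log_le_log (by norm_num) hc)
      · exact Or.inr (Real.log_le_log (by norm_num) (by norm_num at hc ⊢; linarith))
    rcases hor with h | h <;> nlinarith
  · nlinarith

/-- The `t`-interval on which the `k`-th rectangle lives. -/
def slab (k : ℕ) : Set ℝ := Ioo ((2 : ℝ) ^ (-(k : ℤ))) ((2 : ℝ) ^ (1 - (k : ℤ)))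

/-- The horizontal Hilbert transform of the `(j,k)`-th rectangle's slice. -/
def sliceHilbert (j k : ℕ) (x : ℝ) : ℝ :=
  (2 : ℝ) ^ k / Real.pi * (Real.log (x - ((k : ℝ) * 2 ^ (-(j : ℤ)) - 1)) -
    Real.log (x - (((k : ℝ) + 1) * 2 ^ (-(j : ℤ)) - 1)))

lemma eq_of_mem_slab {k l : ℕ} {t : ℝ} (hk : t ∈ slab k) (hl : t ∈ slab l) : k = l := by
  have h1 := (zpow_lt_zpow_iff_right₀ (one_lt_two (α := ℝ))).1 (hk.1.trans hl.2)
  have h2 := (zpow_lt_zpow_iff_right₀ (one_lt_two (α := ℝ))).1 (hl.1.trans hk.2)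
  omega

lemma eq_of_mem_dyadic {i j k : ℕ} (hi : k ∈ Finset.Ico (2 ^ i) (2 ^ (i + 1)))
    (hj : k ∈ Finset.Ico (2 ^ j) (2 ^ (j + 1))) : i = j := by
  rw [Finset.mem_Ico] at hi hj
  have h1 := (Nat.pow_lt_pow_iff_right one_lt_two).1 (hi.1.trans_lt hj.2)
  have h2 := (Nat.pow_lt_pow_iff_right one_lt_two).1 (hj.1.trans_lt hi.2)
  omega

lemma sum_slab_eq {M : Type*} [AddCommMonoid M] {N j k : ℕ} {t : ℝ} (hj : j ≤ N)
    (hk : k ∈ Finset.Ico (2 ^ j) (2 ^ (j + 1))) (ht : t ∈ slab k) (φ : ℕ → ℕ → M) :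
    (∑ i ∈ Finset.range (N + 1), ∑ l ∈ Finset.Ico (2 ^ i) (2 ^ (i + 1)),
      if t ∈ slab l then φ i l else 0) = φ j k := by
  rw [Finset.sum_eq_single j, Finset.sum_eq_single k, if_pos ht]
  · exact fun l _ hl => if_neg fun h => hl (eq_of_mem_slab h ht)
  · exact fun h => absurd hk h
  · refine fun i _ hi => Finset.sum_eq_zero fun l hl => if_neg fun h => hi ?_
    obtain rfl := eq_of_mem_slab h ht
    exact eq_of_mem_dyadic hl hk
  · exact fun h => absurd (Finset.mem_range.2 (by omega)) h

lemma sum_slab_eq_zero {M : Type*} [AddCommMonoid M] {N : ℕ} {t : ℝ}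
    (h : ¬ ∃ j k, j ≤ N ∧ k ∈ Finset.Ico (2 ^ j) (2 ^ (j + 1)) ∧ t ∈ slab k) (φ : ℕ → ℕ → M) :
    (∑ i ∈ Finset.range (N + 1), ∑ l ∈ Finset.Ico (2 ^ i) (2 ^ (i + 1)),
      if t ∈ slab l then φ i l else 0) = 0 :=
  Finset.sum_eq_zero fun i hi => Finset.sum_eq_zero fun l hl =>
    if_neg fun ht => h ⟨i, l, Nat.lt_succ_iff.1 (Finset.mem_range.1 hi), hl, ht⟩

lemma fH_eq_sum_slab (N : ℕ) (t x : ℝ) :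
    fH N t x = ∑ j ∈ Finset.range (N + 1), ∑ k ∈ Finset.Ico (2 ^ j) (2 ^ (j + 1)),
      if t ∈ slab k then
        if x ∈ Ioo ((k : ℝ) * 2 ^ (-(j : ℤ)) - 1) (((k : ℝ) + 1) * 2 ^ (-(j : ℤ)) - 1)
        then (2 : ℝ) ^ k else 0
      else 0 := by
  refine Finset.sum_congr rfl fun j _ => ?_
  have h : Finset.Ico ((2 : ℤ) ^ j) (2 ^ (j + 1)) =
      (Finset.Ico (2 ^ j) (2 ^ (j + 1))).image ((↑) : ℕ → ℤ) := by
    apply Finset.coe_injective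
    rw [Finset.coe_image, Finset.coe_Ico, Finset.coe_Ico, Nat.image_cast_int_Ico]
    push_cast
    rfl
  rw [h, Finset.sum_image fun _ _ _ _ h => Int.natCast_inj.1 h]
  refine Finset.sum_congr rfl fun k _ => ?_
  simp only [ite_and, Int.cast_natCast, zpow_natCast]
  by_cases ht : t ∈ slab k
  · rw [if_pos ht]
    exact if_pos ht
  · rw [if_neg ht]
    exact if_neg ht

namespace IsHilbertOf

variable {N : ℕ} {Hf : ℝ → ℝ → ℝ} {t x : ℝ}

lemma eq_sliceHilbert (hH : IsHilbertOf N Hf) (hx : x ∉ dyadicBad) {j k : ℕ} (hj : j ≤ N)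
    (hk : k ∈ Finset.Ico (2 ^ j) (2 ^ (j + 1))) (ht : t ∈ slab k) :
    Hf t x = sliceHilbert j k x := by
  refine tendsto_nhds_unique (hH t x hx) ?_
  simp only [fH_eq_sum_slab, sum_slab_eq hj hk ht]
  rw [sliceHilbert, div_eq_mul_one_div (2 ^ k : ℝ), mul_comm (2 ^ k : ℝ), mul_assoc]
  refine (tendsto_truncated_integral_indicator _ ?_ ?_ ?_).const_mul _
  · have : (0 : ℝ) < 2 ^ (-(j : ℤ)) := by positivity
    linarith
  · exact fun h => hx ⟨j, k, by simpa using h⟩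
  · exact fun h => hx ⟨j, k + 1, by simpa using h⟩

lemma eq_zero (hH : IsHilbertOf N Hf) (hx : x ∉ dyadicBad)
    (ht : ¬ ∃ j k, j ≤ N ∧ k ∈ Finset.Ico (2 ^ j) (2 ^ (j + 1)) ∧ t ∈ slab k) : Hf t x = 0 := by
  refine tendsto_nhds_unique (hH t x hx) ?_
  simp [fH_eq_sum_slab, sum_slab_eq_zero ht]

lemma ofReal_abs_eq_sum (hH : IsHilbertOf N Hf) (hx : x ∉ dyadicBad) :
    ENNReal.ofReal |Hf t x| =
      ∑ j ∈ Finset.range (N + 1), ∑ k ∈ Finset.Ico (2 ^ j) (2 ^ (j + 1)),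
        if t ∈ slab k then ENNReal.ofReal |sliceHilbert j k x| else 0 := by
  by_cases ht : ∃ j k, j ≤ N ∧ k ∈ Finset.Ico (2 ^ j) (2 ^ (j + 1)) ∧ t ∈ slab k
  · obtain ⟨j, k, hj, hk, ht⟩ := ht
    rw [sum_slab_eq hj hk ht, hH.eq_sliceHilbert hx hj hk ht]
  · rw [sum_slab_eq_zero ht, hH.eq_zero hx ht, abs_zero, ENNReal.ofReal_zero]

end IsHilbertOf

lemma measurable_sliceHilbert (j k : ℕ) : Measurable (sliceHilbert j k) := by
  unfold sliceHilbert
  fun_prop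

lemma volume_dyadicBad : volume dyadicBad = 0 := by
  refine Set.Countable.measure_zero ?_ _
  have : dyadicBad = ⋃ j : ℕ, range fun m : ℤ => (m : ℝ) * 2 ^ (-(j : ℤ)) - 1 := by
    ext x
    simp [dyadicBad, eq_comm]
  rw [this]
  exact countable_iUnion fun j => countable_range _

lemma lintegral_sliceHilbert_bounds {j k : ℕ} (hk : k ∈ Finset.Ico (2 ^ j) (2 ^ (j + 1))) :
    ENNReal.ofReal (Real.log 2 / Real.pi * ((2 : ℝ) ^ k / 2 ^ j) * ((j : ℝ) + 1)) ≤
        ∫⁻ x in Ioo (0 : ℝ) 1, ENNReal.ofReal |sliceHilbert j k x| ∧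
      ∫⁻ x in Ioo (0 : ℝ) 1, ENNReal.ofReal |sliceHilbert j k x| ≤
        ENNReal.ofReal (4 / Real.pi * ((2 : ℝ) ^ k / 2 ^ j) * ((j : ℝ) + 1)) := by
  rw [Finset.mem_Ico] at hk
  have hk1 : (2 : ℝ) ^ j ≤ k := by exact_mod_cast hk.1
  have hk2 : (k : ℝ) + 1 ≤ 2 * 2 ^ j := by
    rw [← pow_succ']
    exact_mod_cast hk.2
  have h2j : (0 : ℝ) < 2 ^ j := by positivity
  set a : ℝ := (k : ℝ) * 2 ^ (-(j : ℤ)) - 1 with ha_def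
  set b : ℝ := ((k : ℝ) + 1) * 2 ^ (-(j : ℤ)) - 1 with hb_def
  have hba : b - a = 1 / 2 ^ j := by
    rw [ha_def, hb_def, zpow_neg, zpow_natCast]
    ring
  have ha : 0 ≤ a := by
    rw [ha_def, zpow_neg, zpow_natCast, sub_nonneg, ← div_eq_mul_inv, le_div_iff₀ h2j]
    linarith
  have hb : b ≤ 1 := by
    rw [hb_def, zpow_neg, zpow_natCast, sub_le_iff_le_add, ← div_eq_mul_inv, div_le_iff₀ h2j]
    linarith
  have hab : a < b := by
    have : 0 < b - a := by rw [hba]; positivity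
    linarith
  obtain ⟨hlo, hup⟩ := integral_abs_log_sub_log_bounds ha hab hb
  have hlog : Real.log (b - a) = -(j * Real.log 2) := by
    rw [hba, one_div, Real.log_inv, Real.log_pow]
  rw [hlog, hba] at hlo hup
  have hint : IntervalIntegrable (fun x => |sliceHilbert j k x|) volume 0 1 :=
    (((intervalIntegrable_log_sub a 0 1).sub (intervalIntegrable_log_sub b 0 1)).const_mul _).abs
  rw [intervalIntegrable_iff_integrableOn_Ioo_of_le zero_le_one] at hint
  have hval : ∫ x in Ioo (0 : ℝ) 1, |sliceHilbert j k x| =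
      2 ^ k / Real.pi * ∫ x in (0 : ℝ)..1, |Real.log (x - a) - Real.log (x - b)| := by
    rw [← integral_Ioc_eq_integral_Ioo, ← intervalIntegral.integral_of_le zero_le_one,
      ← intervalIntegral.integral_const_mul]
    congr 1
    ext x
    rw [sliceHilbert, abs_mul, abs_of_nonneg (by positivity : (0 : ℝ) ≤ 2 ^ k / Real.pi)]
  rw [← ofReal_integral_eq_lintegral_ofReal hint (ae_of_all _ fun x => abs_nonneg _), hval]
  have hc : (0 : ℝ) ≤ 2 ^ k / Real.pi := by positivity
  constructor <;> refine ENNReal.ofReal_le_ofReal ?_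
  · refine le_trans (le_of_eq ?_) (mul_le_mul_of_nonneg_left hlo hc)
    field_simp
    ring
  · refine (mul_le_mul_of_nonneg_left hup hc).trans ?_
    have hl : j * Real.log 2 ≤ j * 1 :=
      mul_le_mul_of_nonneg_left (by linarith [Real.log_two_lt_d9]) (Nat.cast_nonneg j)
    calc (2 : ℝ) ^ k / Real.pi * (1 / 2 ^ j * (4 - 2 * -(j * Real.log 2)))
        ≤ 2 ^ k / Real.pi * (1 / 2 ^ j * (4 * (j + 1))) := by
          gcongr
          have : (0 : ℝ) ≤ j := Nat.cast_nonneg j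
          linarith
      _ = 4 / Real.pi * (2 ^ k / 2 ^ j) * (j + 1) := by ring

lemma volume_slab_inter {k : ℕ} (hk : 1 ≤ k) :
    volume (slab k ∩ Ioo 0 1) = ENNReal.ofReal ((2 ^ k)⁻¹) := by
  have h : slab k ⊆ Ioo 0 1 := by
    refine Ioo_subset_Ioo (by positivity) ?_
    exact zpow_le_one_of_nonpos₀ one_le_two (by omega)
  rw [inter_eq_left.2 h, slab, Real.volume_Ioo, zpow_sub₀ two_ne_zero, zpow_neg, zpow_natCast]
  congr 1
  rw [zpow_one]
  ring

lemma lintegral_prod_hilbert {N : ℕ} {Hf : ℝ → ℝ → ℝ} (hH : IsHilbertOf N Hf) :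
    ∫⁻ z in Ioo (0 : ℝ) 1 ×ˢ Ioo (0 : ℝ) 1, ENNReal.ofReal |Hf z.1 z.2| =
      ∑ j ∈ Finset.range (N + 1), ∑ k ∈ Finset.Ico (2 ^ j) (2 ^ (j + 1)),
        ENNReal.ofReal ((2 ^ k)⁻¹) *
          ∫⁻ x in Ioo (0 : ℝ) 1, ENNReal.ofReal |sliceHilbert j k x| := by
  have hbad : ∀ᵐ z : ℝ × ℝ ∂(volume.restrict (Ioo (0 : ℝ) 1)).prod
      (volume.restrict (Ioo (0 : ℝ) 1)), z.2 ∉ dyadicBad := by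
    refine Measure.quasiMeasurePreserving_snd.ae (p := fun x => x ∉ dyadicBad) ?_
    exact ae_restrict_of_ae (measure_eq_zero_iff_ae_notMem.1 volume_dyadicBad)
  have hmeas : ∀ j k : ℕ, Measurable fun x => ENNReal.ofReal |sliceHilbert j k x| := fun j k =>
    ((measurable_sliceHilbert j k).abs).ennreal_ofReal
  have hslab : ∀ k, MeasurableSet (slab k) := fun k => measurableSet_Ioo
  have hone : ∀ k, Measurable ((slab k).indicator (1 : ℝ → ℝ≥0∞)) := fun k =>
    (measurable_const (a := (1 : ℝ≥0∞))).indicator (hslab k)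
  have hterm : ∀ (j k : ℕ) (z : ℝ × ℝ),
      (if z.1 ∈ slab k then ENNReal.ofReal |sliceHilbert j k z.2| else 0) =
        (slab k).indicator 1 z.1 * ENNReal.ofReal |sliceHilbert j k z.2| := by
    intro j k z
    by_cases h : z.1 ∈ slab k <;> simp [h]
  rw [Measure.volume_eq_prod, ← Measure.prod_restrict,
    lintegral_congr_ae (hbad.mono fun z hz => hH.ofReal_abs_eq_sum hz)]
  simp only [hterm]
  have hm : ∀ j k : ℕ, Measurable fun z : ℝ × ℝ =>
      (slab k).indicator (1 : ℝ → ℝ≥0∞) z.1 * ENNReal.ofReal |sliceHilbert j k z.2| := fun j k =>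
    ((hone k).comp measurable_fst).mul ((hmeas j k).comp measurable_snd)
  rw [lintegral_finsetSum _ fun j _ => Finset.measurable_sum _ fun k _ => hm j k]
  refine Finset.sum_congr rfl fun j _ => ?_
  rw [lintegral_finsetSum _ fun k _ => hm j k]
  refine Finset.sum_congr rfl fun k hk => ?_
  rw [lintegral_prod_mul (hone k).aemeasurable (hmeas j k).aemeasurable,
    lintegral_indicator_one (hslab k), Measure.restrict_apply (hslab k),
    volume_slab_inter (Nat.one_le_two_pow.trans (Finset.mem_Ico.1 hk).1)]

lemma sum_dyadic_ofReal {c : ℝ} (hc : 0 ≤ c) (N : ℕ) :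
    (∑ j ∈ Finset.range (N + 1), ∑ k ∈ Finset.Ico (2 ^ j) (2 ^ (j + 1)),
      ENNReal.ofReal ((2 ^ k)⁻¹) * ENNReal.ofReal (c * ((2 : ℝ) ^ k / 2 ^ j) * ((j : ℝ) + 1))) =
      ENNReal.ofReal (c * ((N + 1) * (N + 2) / 2)) := by
  have hterm : ∀ j k : ℕ, ENNReal.ofReal ((2 ^ k)⁻¹) *
      ENNReal.ofReal (c * ((2 : ℝ) ^ k / 2 ^ j) * ((j : ℝ) + 1)) =
        ENNReal.ofReal (c * (j + 1) / 2 ^ j) := by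
    intro j k
    rw [← ENNReal.ofReal_mul (by positivity)]
    congr 1
    field_simp
  simp only [hterm]
  induction N with
  | zero => simp [show (2 : ℝ≥0∞) - 1 = 1 by
      rw [← one_add_one_eq_two]
      exact ENNReal.add_sub_cancel_right ENNReal.one_ne_top]
  | succ n ih =>
    rw [Finset.sum_range_succ, ih, Finset.sum_const, Nat.card_Ico, nsmul_eq_mul,
      ← ENNReal.ofReal_natCast, ← ENNReal.ofReal_mul (by positivity),
      ← ENNReal.ofReal_add (by positivity) (by positivity), pow_succ 2 (n + 1), mul_two,
      Nat.add_sub_cancel]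
    congr 1
    push_cast
    field_simp
    ring

/-- Horizontal Hilbert transform counterexample, lower bound:
`∫₀¹ |Hf_N(t,x)| dx ≈ 2^{k-j}(j+1)` for `t ∈ (2^{-k}, 2^{1-k})`, `2^j ≤ k < 2^{j+1}`,
`j ≤ N`, and consequently `∫_{[0,1]²} |Hf_N| ≈ N²`. -/
theorem hilbert_counterexample_lower_bound :
    ∃ c₁ c₂ c₃ c₄ : ℝ, 0 < c₁ ∧ 0 < c₂ ∧ 0 < c₃ ∧ 0 < c₄ ∧
      ∀ (N : ℕ), 1 ≤ N → ∀ Hf : ℝ → ℝ → ℝ, IsHilbertOf N Hf →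
        (∀ (j k : ℕ) (t : ℝ), j ≤ N → 2 ^ j ≤ k → k < 2 ^ (j + 1) →
          t ∈ Set.Ioo ((2 : ℝ) ^ (-(k : ℤ))) ((2 : ℝ) ^ (1 - (k : ℤ))) →
            ENNReal.ofReal (c₁ * ((2 : ℝ) ^ k / 2 ^ j) * ((j : ℝ) + 1)) ≤
              (∫⁻ x in Set.Ioo (0 : ℝ) 1, ENNReal.ofReal |Hf t x|) ∧
            (∫⁻ x in Set.Ioo (0 : ℝ) 1, ENNReal.ofReal |Hf t x|) ≤
              ENNReal.ofReal (c₂ * ((2 : ℝ) ^ k / 2 ^ j) * ((j : ℝ) + 1))) ∧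
        ENNReal.ofReal (c₃ * (N : ℝ) ^ 2) ≤
          (∫⁻ z in Set.Ioo (0 : ℝ) 1 ×ˢ Set.Ioo (0 : ℝ) 1,
            ENNReal.ofReal |Hf z.1 z.2|) ∧
        (∫⁻ z in Set.Ioo (0 : ℝ) 1 ×ˢ Set.Ioo (0 : ℝ) 1,
            ENNReal.ofReal |Hf z.1 z.2|) ≤ ENNReal.ofReal (c₄ * (N : ℝ) ^ 2) := by
  have hl2 : 0 < Real.log 2 := Real.log_pos one_lt_two
  have hpi := Real.pi_pos
  refine ⟨Real.log 2 / Real.pi, 4 / Real.pi, Real.log 2 / Real.pi / 2, 4 / Real.pi * 3,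
    by positivity, by positivity, by positivity, by positivity, fun N hN Hf hH => ⟨?_, ?_, ?_⟩⟩
  · intro j k t hj hk1 hk2 ht
    have hk := Finset.mem_Ico.2 ⟨hk1, hk2⟩
    have heq : ∫⁻ x in Ioo (0 : ℝ) 1, ENNReal.ofReal |Hf t x| =
        ∫⁻ x in Ioo (0 : ℝ) 1, ENNReal.ofReal |sliceHilbert j k x| := by
      refine lintegral_congr_ae (ae_restrict_of_ae ?_)
      filter_upwards [measure_eq_zero_iff_ae_notMem.1 volume_dyadicBad] with x hx
      rw [hH.eq_sliceHilbert hx hj hk ht]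
    rw [heq]
    exact lintegral_sliceHilbert_bounds hk
  · rw [lintegral_prod_hilbert hH]
    calc _ ≤ ENNReal.ofReal (Real.log 2 / Real.pi * ((N + 1) * (N + 2) / 2)) := by
          rw [div_mul_eq_mul_div, mul_div_assoc]
          gcongr
          nlinarith
      _ ≤ _ := by
          rw [← sum_dyadic_ofReal (by positivity)]
          gcongr with j _ k hk
          exact (lintegral_sliceHilbert_bounds hk).1
  · rw [lintegral_prod_hilbert hH]
    calc _ ≤ ENNReal.ofReal (4 / Real.pi * ((N + 1) * (N + 2) / 2)) := by
          rw [← sum_dyadic_ofReal (by positivity)]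
          gcongr with j _ k hk
          exact (lintegral_sliceHilbert_bounds hk).2
      _ ≤ _ := by
          have hN' : (1 : ℝ) ≤ N := by exact_mod_cast hN
          rw [mul_assoc]
          gcongr
          nlinarith
end
end
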